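/- Let A be the adjacency matrix of a connected, non-complete, inhomogeneous, 6-regular and 2 net-regular strongly regular signed graph with parameters (n, 6, a, b, c) lying in the class C1 ∪ C4 ∪ C5. If A contains an unbalanced triangle of the second type and b = 1, then n ≥ 15. -/

import Mathlib

open Finset in
/-- In a 6-regular, 2 net-regular signed graph every vertex has four positive and two negative
neighbours. -/
lemma card_pos_and_card_neg {n : ℕ} (A : Matrix (Fin n) (Fin n) ℤ)
    (hent : ∀ i j, A i j = -1 ∨ A i j = 0 ∨ A i j = 1)
    (hreg : ∀ i, (univ.filter (fun j => A i j ≠ 0)).card = 6)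
    (hnet : ∀ i, ∑ j, A i j = 2) (i : Fin n) :
    (univ.filter (fun j => A i j = 1)).card = 4 ∧
      (univ.filter (fun j => A i j = -1)).card = 2 := by
  have hsum : ((univ.filter (fun j => A i j = 1)).card : ℤ) -
      (univ.filter (fun j => A i j = -1)).card = 2 := by
    rw [← hnet i, card_filter, card_filter]
    push_cast
    rw [← sum_sub_distrib]
    refine sum_congr rfl fun j _ => ?_
    rcases hent i j with h | h | h <;> simp [h]
  have hadd : ((univ.filter (fun j => A i j = 1)).card : ℤ) +
      (univ.filter (fun j => A i j = -1)).card = 6 := by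
    have h6 : ((univ.filter (fun j => A i j ≠ 0)).card : ℤ) = 6 := by exact_mod_cast hreg i
    rw [← h6, card_filter, card_filter, card_filter]
    push_cast
    rw [← sum_add_distrib]
    refine sum_congr rfl fun j _ => ?_
    rcases hent i j with h | h | h <;> simp [h]
  omega

/-- If a vertex has exactly two negative neighbours, any negative neighbour is one of two given
distinct ones. -/
lemma eq_or_eq_of_card_neg_eq_two {n : ℕ} {A : Matrix (Fin n) (Fin n) ℤ} {i j k x : Fin n}
    (hcard : (Finset.univ.filter (fun y => A i y = -1)).card = 2)
    (hjk : j ≠ k) (hj : A i j = -1) (hk : A i k = -1) (hx : A i x = -1) : x = j ∨ x = k := by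
  have hsub : ({j, k} : Finset (Fin n)) ⊆ Finset.univ.filter (fun y => A i y = -1) := by
    intro y hy
    rcases Finset.mem_insert.1 hy with rfl | hy
    · simpa using hj
    · simpa [Finset.mem_singleton.1 hy] using hk
  have heq := Finset.eq_of_subset_of_card_le hsub (by rw [hcard, Finset.card_pair hjk])
  have hmem : x ∈ ({j, k} : Finset (Fin n)) := by simp [heq, hx]
  simpa using hmem

/-- Two vertices of an all-negative triangle have no common positive neighbour, provided that all
their negative neighbours lie in the triangle and the negative edge between them has
`(A * A) i j = 1`. -/
lemma disjoint_pos_neighbors {n : ℕ} {A : Matrix (Fin n) (Fin n) ℤ} {i j k : Fin n}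
    (hsymm : ∀ i j, A i j = A j i) (hdiag : ∀ i, A i i = 0)
    (hent : ∀ i j, A i j = -1 ∨ A i j = 0 ∨ A i j = 1)
    (hi : ∀ x, A i x = -1 → x = j ∨ x = k) (hj : ∀ x, A j x = -1 → x = i ∨ x = k)
    (hik : A i k = -1) (hjk : A j k = -1) (hAA : (A * A) i j = 1) :
    Disjoint (Finset.univ.filter (fun x => A i x = 1))
      (Finset.univ.filter (fun x => A j x = 1)) := by
  rw [Finset.disjoint_left]
  intro x hxi hxj
  simp only [Finset.mem_filter, Finset.mem_univ, true_and] at hxi hxj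
  have hnonneg : ∀ y, 0 ≤ A i y * A y j := by
    intro y
    rw [hsymm y j]
    rcases hent i y with h | h | h
    · rcases hi y h with rfl | rfl
      · simp [hdiag]
      · simp [h, hjk]
    · simp [h]
    · rcases hent j y with h' | h' | h'
      · rcases hj y h' with rfl | rfl
        · simp [hdiag]
        · omega
      · simp [h']
      · simp [h, h']
  have hkx : k ≠ x := by
    rintro rfl
    omega
  have hle : ∑ y ∈ {k, x}, A i y * A y j ≤ ∑ y, A i y * A y j :=
    Finset.sum_le_sum_of_subset_of_nonneg (Finset.subset_univ _) fun y _ _ => hnonneg y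
  rw [Finset.sum_pair hkx, ← Matrix.mul_apply, hAA, hsymm k j, hsymm x j, hik, hjk, hxi,
    hxj] at hle
  omega


theorem stmt13 {n : ℕ} (A : Matrix (Fin n) (Fin n) ℤ) (a b c : ℤ)
    (hsymm : ∀ i j, A i j = A j i)
    (hdiag : ∀ i, A i i = 0)
    (hent : ∀ i j, A i j = -1 ∨ A i j = 0 ∨ A i j = 1)
    (hconn : (SimpleGraph.fromRel (fun i j => A i j ≠ 0)).Connected)
    (hncomp : ¬ ∀ i j : Fin n, i ≠ j → A i j ≠ 0)
    (hinhom : (∃ i j, A i j = 1) ∧ (∃ i j, A i j = -1))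
    (hreg : ∀ i, (Finset.univ.filter (fun j => A i j ≠ 0)).card = 6)
    (hnet : ∀ i, ∑ j, A i j = 2)
    (hAA : ∀ i, (A * A) i i = 6)
    (hpos : ∀ i j, A i j = 1 → (A * A) i j = a)
    (hneg : ∀ i j, A i j = -1 → (A * A) i j = b)
    (hnon : ∀ i j, i ≠ j → A i j = 0 → (A * A) i j = c)
    (hclass : ¬(a = -b ∧ c = 0) ∧ ¬(a ≠ -b ∧ 2 * c = a + b))
    (htri2 : ∃ i j k : Fin n, A i j = -1 ∧ A j k = -1 ∧ A i k = -1)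
    (hb : b = 1) :
    15 ≤ n := by
  subst hb
  obtain ⟨i, j, k, hij, hjk, hik⟩ := htri2
  have hji : A j i = -1 := (hsymm j i).trans hij
  have hkj : A k j = -1 := (hsymm k j).trans hjk
  have hki : A k i = -1 := (hsymm k i).trans hik
  have hne : ∀ x y, A x y = -1 → x ≠ y := by
    rintro x _ h rfl
    simp [hdiag] at h
  have hcard := card_pos_and_card_neg A hent hreg hnet
  have hi := fun x => eq_or_eq_of_card_neg_eq_two (x := x) (hcard i).2 (hne j k hjk) hij hik
  have hj := fun x => eq_or_eq_of_card_neg_eq_two (x := x) (hcard j).2 (hne i k hik) hji hjk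
  have hk := fun x => eq_or_eq_of_card_neg_eq_two (x := x) (hcard k).2 (hne i j hij) hki hkj
  have dij := disjoint_pos_neighbors hsymm hdiag hent hi hj hik hjk (hneg i j hij)
  have dik := disjoint_pos_neighbors hsymm hdiag hent (fun x h => (hi x h).symm) hk hij hkj
    (hneg i k hik)
  have djk := disjoint_pos_neighbors hsymm hdiag hent (fun x h => (hj x h).symm)
    (fun x h => (hk x h).symm) hji hki (hneg j k hjk)
  have htri : ({i, j, k} : Finset (Fin n)).card = 3 :=
    Finset.card_eq_three.2 ⟨i, j, k, hne i j hij, hne i k hik, hne j k hjk, rfl⟩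
  have dtri : Disjoint ({i, j, k} : Finset (Fin n))
      (Finset.univ.filter (fun x => A i x = 1) ∪ Finset.univ.filter (fun x => A j x = 1) ∪
        Finset.univ.filter (fun x => A k x = 1)) := by
    simp [hdiag, hij, hik, hji, hjk, hki, hkj]
  have hle := Finset.card_le_univ (({i, j, k} : Finset (Fin n)) ∪
      (Finset.univ.filter (fun x => A i x = 1) ∪ Finset.univ.filter (fun x => A j x = 1) ∪
        Finset.univ.filter (fun x => A k x = 1)))
  rw [Finset.card_union_of_disjoint dtri,
    Finset.card_union_of_disjoint (Finset.disjoint_union_left.2 ⟨dik, djk⟩),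
    Finset.card_union_of_disjoint dij, htri, (hcard i).1, (hcard j).1, (hcard k).1,
    Fintype.card_fin] at hle
  exact hle
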